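/- arXiv:2507.00405 — 4 statements merged into one kernel-verified Lean document; each statement's English description precedes it below -/
import Mathlib

section
/- The series ∑_{n=0}^∞ (1/|1-2n|) · C(2n,n) · 2^{-3n} converges and its sum equals 2 - 2^{-1/2}. -/
theorem Ring.succ_mul_choose_succ {R : Type*} [CommRing R] [BinomialRing R] (r : R) (n : ℕ) :
    ((n : R) + 1) * Ring.choose r (n + 1) = (r - n) * Ring.choose r n := by
  have h := Ring.choose_smul_choose r (Nat.le_succ n)
  simpa [Nat.choose_succ_self_right, Ring.choose_one_right, mul_comm] using h

theorem one_sub_two_mul_natCast_ne_zero (n : ℕ) : (1 - 2 * (n : ℝ)) ≠ 0 := by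
  intro h
  have h' : 2 * n = 1 := by exact_mod_cast (sub_eq_zero.mp h).symm
  lia

theorem Ring.choose_one_half (n : ℕ) :
    Ring.choose (1 / 2 : ℝ) n = (-1 / 4) ^ n * n.centralBinom / (1 - 2 * n) := by
  induction n with
  | zero => simp
  | succ n ih =>
    have hn := one_sub_two_mul_natCast_ne_zero n
    have hn' : 1 - 2 * ((n : ℝ) + 1) ≠ 0 := by
      exact_mod_cast one_sub_two_mul_natCast_ne_zero (n + 1)
    have hpos : (n : ℝ) + 1 ≠ 0 := by positivity
    have hc : ((n : ℝ) + 1) * (n + 1).centralBinom = 2 * (2 * n + 1) * n.centralBinom := by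
      exact_mod_cast n.succ_mul_centralBinom_succ
    apply mul_left_cancel₀ hpos
    rw [Ring.succ_mul_choose_succ, ih, Nat.cast_succ, mul_div_assoc' ((n : ℝ) + 1),
      mul_left_comm ((n : ℝ) + 1), hc]
    field_simp
    ring

theorem hasSum_centralBinom_div_mul_pow {x : ℝ} (hx : |4 * x| < 1) :
    HasSum (fun n : ℕ => (n.centralBinom : ℝ) / (1 - 2 * n) * x ^ n)
      ((1 - 4 * x) ^ (1 / 2 : ℝ)) := by
  have hmem : -(4 * x) ∈ Metric.eball (0 : ℝ) 1 := by
    rw [← ENNReal.ofReal_one, Metric.eball_ofReal]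
    simpa using hx
  have h := (Real.one_add_rpow_hasFPowerSeriesOnBall_zero (a := 1 / 2)).hasSum hmem
  rw [zero_add, ← sub_eq_add_neg] at h
  refine h.congr_fun fun n => ?_
  rw [binomialSeries_apply, Ring.choose_one_half, List.ofFn_const, List.prod_replicate,
    smul_eq_mul, show -(4 * x) = (-4) * x by ring, mul_pow, div_mul_eq_mul_div, div_mul_eq_mul_div]
  have : (-1 / 4 : ℝ) ^ n * (-4) ^ n = 1 := by rw [← mul_pow]; norm_num
  congr 1
  linear_combination (-(n.centralBinom : ℝ) * x ^ n) * this

/-- The series `∑_{n=0}^∞ (1/|1-2n|) · C(2n,n) · 2^{-3n}` converges with sum `2 - 2^{-1/2}`. -/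
theorem abs_coeff_series :
    HasSum (fun n : ℕ => (1 / |1 - 2 * (n : ℝ)|) * (n.centralBinom : ℝ) * ((2 : ℝ) ^ (3 * n))⁻¹)
      (2 - (2 : ℝ) ^ (-(1 / 2) : ℝ)) := by
  have h := (hasSum_ite_eq (0 : ℕ) (2 : ℝ)).sub
    (hasSum_centralBinom_div_mul_pow (x := 1 / 8) (by norm_num [abs_lt]))
  have hval : (1 - 4 * (1 / 8) : ℝ) ^ (1 / 2 : ℝ) = 2 ^ (-(1 / 2) : ℝ) := by
    rw [Real.rpow_neg zero_le_two, ← Real.inv_rpow zero_le_two]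
    norm_num
  rw [hval] at h
  refine h.congr_fun fun n => ?_
  rcases Nat.eq_zero_or_pos n with rfl | hn
  · norm_num
  · have hn1 : (1 : ℝ) ≤ n := by exact_mod_cast hn
    rw [if_neg hn.ne', abs_of_neg (by linarith), one_div_neg_eq_neg_one_div, pow_mul, ← inv_pow]
    norm_num
    ring
end

section
/- There exists a constant C > 0 such that for every real w > 0 and every real ε with 0 < ε ≤ 1 there exists a real polynomial p with degree at most C·(1 + max(1/w, √(log(1/ε))))·(1 + √(log(1/ε))) satisfying |p(x) - exp(-π x²/(2w²))| ≤ ε for all x ∈ [-1,1]. -/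
/-- The product of the exponential series of `r * exp v` and `r * exp (-v)`, as a double series. -/
theorem hasSum_exp_two_mul_cosh (r : ℝ) (v : ℂ) :
    HasSum (fun q : ℕ × ℕ => ((r ^ q.1 / q.1.factorial * (r ^ q.2 / q.2.factorial) : ℝ) : ℂ) *
      Complex.exp (((q.1 : ℤ) - (q.2 : ℤ) : ℤ) * v)) (Complex.exp (2 * r * Complex.cosh v)) := by
  have hs (z : ℂ) : HasSum (fun n : ℕ => z ^ n / n.factorial) (Complex.exp z) := by
    rw [Complex.exp_eq_exp_ℂ]
    exact NormedSpace.expSeries_div_hasSum_exp z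
  have hn (z : ℂ) : Summable fun n : ℕ => ‖z ^ n / n.factorial‖ :=
    NormedSpace.norm_expSeries_div_summable z
  have h := (summable_mul_of_summable_norm (hn (r * Complex.exp v))
    (hn (r * Complex.exp (-v)))).hasSum
  rw [← tsum_mul_tsum_of_summable_norm (hn (r * Complex.exp v)) (hn (r * Complex.exp (-v))),
    (hs _).tsum_eq, (hs _).tsum_eq] at h
  have hexp : Complex.exp (r * Complex.exp v) * Complex.exp (r * Complex.exp (-v)) =
      Complex.exp (2 * r * Complex.cosh v) := by
    rw [← Complex.exp_add, ← mul_add, ← Complex.two_cosh, mul_left_comm, ← mul_assoc]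
  rw [hexp] at h
  convert! h using 2 with q
  have hq : Complex.exp (((q.1 : ℤ) - (q.2 : ℤ) : ℤ) * v) =
      Complex.exp v ^ q.1 * Complex.exp (-v) ^ q.2 := by
    rw [← Complex.exp_nat_mul, ← Complex.exp_nat_mul, ← Complex.exp_add]
    push_cast
    ring_nf
  rw [hq]
  push_cast
  ring

theorem hasSum_exp_two_mul_cos (r θ : ℝ) :
    HasSum (fun q : ℕ × ℕ => r ^ q.1 / q.1.factorial * (r ^ q.2 / q.2.factorial) *
      Real.cos (((q.1 : ℤ) - (q.2 : ℤ) : ℤ) * θ)) (Real.exp (2 * r * Real.cos θ)) := by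
  have h := Complex.hasSum_re (hasSum_exp_two_mul_cosh r (θ * Complex.I))
  convert h using 1
  · ext q
    rw [Complex.re_ofReal_mul, ← mul_assoc]
    have := Complex.exp_ofReal_mul_I_re ((((q.1 : ℤ) - (q.2 : ℤ) : ℤ) : ℝ) * θ)
    rw [← this]
    push_cast
    rfl
  · rw [Complex.cosh_mul_I, ← Complex.ofReal_cos, ← Complex.exp_ofReal_re]
    push_cast
    rfl

theorem hasSum_exp_two_mul_real_cosh (r u : ℝ) :
    HasSum (fun q : ℕ × ℕ => r ^ q.1 / q.1.factorial * (r ^ q.2 / q.2.factorial) *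
      Real.exp (((q.1 : ℤ) - (q.2 : ℤ) : ℤ) * u)) (Real.exp (2 * r * Real.cosh u)) := by
  have h := hasSum_exp_two_mul_cosh r u
  exact_mod_cast h

theorem one_le_exp_mul_exp_add_exp {d : ℕ} {k : ℤ} (hk : d < k.natAbs) {u : ℝ} (hu : 0 ≤ u) :
    1 ≤ Real.exp (-(d * u)) * (Real.exp (k * u) + Real.exp (k * -u)) := by
  rw [mul_add, ← Real.exp_add, ← Real.exp_add]
  have hk' : (d : ℝ) ≤ |(k : ℝ)| := by
    rw [← Int.cast_abs, Int.abs_eq_natAbs]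
    exact_mod_cast hk.le
  rcases le_abs'.mp hk' with h | h
  · have : 1 ≤ Real.exp (-(d * u) + k * -u) := Real.one_le_exp (by nlinarith)
    linarith [Real.exp_pos (-(d * u) + k * u)]
  · have : 1 ≤ Real.exp (-(d * u) + k * u) := Real.one_le_exp (by nlinarith)
    linarith [Real.exp_pos (-(d * u) + k * -u)]

open Polynomial in
/-- Truncating the Chebyshev expansion of `x ↦ exp (2 * r * x)` at degree `d`. -/
theorem exists_polynomial_abs_sub_exp_le {r : ℝ} (hr : 0 ≤ r) (d : ℕ) {u : ℝ} (hu : 0 ≤ u) :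
    ∃ p : ℝ[X], p.natDegree ≤ d ∧ ∀ x ∈ Set.Icc (-1 : ℝ) 1,
      |p.eval x - Real.exp (2 * r * x)| ≤
        2 * Real.exp (-(d * u)) * Real.exp (2 * r * Real.cosh u) := by
  set a : ℕ × ℕ → ℝ := fun q => r ^ q.1 / q.1.factorial * (r ^ q.2 / q.2.factorial) with ha
  have ha0 : ∀ q, 0 ≤ a q := fun q => by positivity
  set D : ℕ × ℕ → ℤ := fun q => (q.1 : ℤ) - (q.2 : ℤ) with hD
  have hsa : Summable a := by
    simpa [ha] using (hasSum_exp_two_mul_real_cosh r 0).summable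
  set s : Finset ℤ := Finset.Icc (-(d : ℤ)) d with hs
  have hmem : ∀ k, k ∈ s ↔ k.natAbs ≤ d := fun k => by
    rw [hs, Finset.mem_Icc]; omega
  set b : ℤ → ℕ × ℕ → ℝ := fun k q => if D q = k then a q else 0 with hb
  have hsb : ∀ k, Summable (b k) := fun k =>
    hsa.of_nonneg_of_le (fun q => by simp only [hb]; split_ifs <;> simp [ha0])
      (fun q => by simp only [hb]; split_ifs <;> simp [ha0])
  refine ⟨∑ k ∈ s, C (∑' q, b k q) * Chebyshev.T ℝ k, ?_, ?_⟩
  · refine natDegree_sum_le_of_forall_le _ _ fun k hk => ?_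
    refine (natDegree_C_mul_le _ _).trans ?_
    rw [Chebyshev.natDegree_T]
    exact (hmem k).mp hk
  · intro x hx
    obtain ⟨θ, rfl⟩ : ∃ θ, Real.cos θ = x := ⟨Real.arccos x, Real.cos_arccos hx.1 hx.2⟩
    have h1 : HasSum (fun q => ∑ k ∈ s, b k q * Real.cos (k * θ))
        (eval (Real.cos θ) (∑ k ∈ s, C (∑' q, b k q) * Chebyshev.T ℝ k)) := by
      rw [eval_finsetSum]
      refine hasSum_sum fun k _ => ?_
      rw [eval_mul, eval_C, Chebyshev.T_real_cos]
      exact (hsb k).hasSum.mul_right _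
    have h2 := h1.sub (hasSum_exp_two_mul_cos r θ)
    have h3 := ((hasSum_exp_two_mul_real_cosh r u).add
      (hasSum_exp_two_mul_real_cosh r (-u))).mul_left (Real.exp (-(d * u)))
    rw [Real.cosh_neg, ← two_mul, ← mul_assoc, mul_comm _ (2 : ℝ)] at h3
    rw [← h2.tsum_eq, ← Real.norm_eq_abs]
    refine tsum_of_norm_bounded h3 fun q => ?_
    have h4 : ∑ k ∈ s, b k q * Real.cos (k * θ) =
        if D q ∈ s then a q * Real.cos (D q * θ) else 0 := by
      simp only [hb, ite_mul, zero_mul]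
      exact Finset.sum_ite_eq s (D q) fun k => a q * Real.cos (k * θ)
    rw [h4]
    change ‖_ - a q * Real.cos (D q * θ)‖ ≤ Real.exp (-(d * u)) *
      (a q * Real.exp (D q * u) + a q * Real.exp (D q * -u))
    rw [← mul_add, mul_left_comm]
    split_ifs with hq
    · rw [sub_self, norm_zero]
      have := ha0 q
      positivity
    · rw [hmem, not_le] at hq
      rw [zero_sub, norm_neg, norm_mul, Real.norm_of_nonneg (ha0 q), Real.norm_eq_abs]
      exact mul_le_mul_of_nonneg_left
        ((Real.abs_cos_le_one _).trans (one_le_exp_mul_exp_add_exp hq hu)) (ha0 q)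

theorem Real.cosh_le_one_add_sq {u : ℝ} (hu0 : 0 ≤ u) (hu1 : u ≤ 1) :
    Real.cosh u ≤ 1 + u ^ 2 := by
  have h1 := Real.cosh_le_exp_half_sq u
  have h0 : |u ^ 2 / 2| = u ^ 2 / 2 := abs_of_nonneg (by positivity)
  have h2 := Real.abs_exp_sub_one_le (x := u ^ 2 / 2) (by rw [h0]; nlinarith)
  rw [h0] at h2
  linarith [le_abs_self (Real.exp (u ^ 2 / 2) - 1)]

open Polynomial in
/-- Approximation of `x ↦ exp (-(4 * r) * x ^ 2)` by polynomials of degree `2 * d`. -/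
theorem exists_polynomial_abs_sub_exp_neg_sq_le {r : ℝ} (hr : 0 ≤ r) (d : ℕ) {u : ℝ}
    (hu0 : 0 ≤ u) (hu1 : u ≤ 1) :
    ∃ p : ℝ[X], p.natDegree ≤ 2 * d ∧ ∀ x ∈ Set.Icc (-1 : ℝ) 1,
      |p.eval x - Real.exp (-(4 * r * x ^ 2))| ≤ 2 * Real.exp (2 * r * u ^ 2 - d * u) := by
  obtain ⟨p, hp, hpx⟩ := exists_polynomial_abs_sub_exp_le hr d hu0
  refine ⟨C (Real.exp (-(2 * r))) * p.comp (1 - C 2 * X ^ 2), ?_, fun x hx => ?_⟩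
  · refine (natDegree_C_mul_le _ _).trans (natDegree_comp_le.trans ?_)
    have : (1 - C 2 * X ^ 2 : ℝ[X]).natDegree ≤ 2 := by compute_degree
    calc _ ≤ d * 2 := Nat.mul_le_mul hp this
      _ = 2 * d := mul_comm _ _
  · have hx2 : x ^ 2 ≤ 1 := by nlinarith [hx.1, hx.2]
    have h := hpx (1 - 2 * x ^ 2) ⟨by linarith, by nlinarith [sq_nonneg x]⟩
    have he : Real.exp (-(4 * r * x ^ 2)) =
        Real.exp (-(2 * r)) * Real.exp (2 * r * (1 - 2 * x ^ 2)) := by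
      rw [← Real.exp_add]
      ring_nf
    have hev : (C (Real.exp (-(2 * r))) * p.comp (1 - C 2 * X ^ 2)).eval x =
        Real.exp (-(2 * r)) * p.eval (1 - 2 * x ^ 2) := by
      simp
    rw [hev, he, ← mul_sub, abs_mul, abs_of_pos (Real.exp_pos _)]
    refine (mul_le_mul_of_nonneg_left h (Real.exp_pos _).le).trans ?_
    rw [mul_assoc, mul_left_comm, ← Real.exp_add, ← Real.exp_add]
    gcongr
    nlinarith [mul_le_mul_of_nonneg_left (Real.cosh_le_one_add_sq hu0 hu1) hr]

/-- Polynomial approximation of the Gaussian: there is `C > 0` such that for every `w > 0`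
and `0 < ε ≤ 1` there is a real polynomial of degree at most
`C·(1 + max(1/w, √(log(1/ε))))·(1 + √(log(1/ε)))` that is uniformly `ε`-close to
`x ↦ exp(-π x²/(2w²))` on `[-1,1]`. -/
theorem poly_approx_gaussian :
    ∃ C : ℝ, 0 < C ∧ ∀ w : ℝ, 0 < w → ∀ ε : ℝ, 0 < ε → ε ≤ 1 →
      ∃ p : Polynomial ℝ,
        (p.natDegree : ℝ) ≤
          C * (1 + max (1 / w) (Real.sqrt (Real.log (1 / ε)))) *
            (1 + Real.sqrt (Real.log (1 / ε))) ∧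
        ∀ x ∈ Set.Icc (-1 : ℝ) 1,
          |p.eval x - Real.exp (-(Real.pi * x ^ 2) / (2 * w ^ 2))| ≤ ε := by
  refine ⟨6, by norm_num, fun w hw ε hε hε1 => ?_⟩
  have hl : 0 ≤ Real.log (1 / ε) := Real.log_nonneg (by rw [le_div_iff₀ hε]; linarith)
  have hsq := Real.sq_sqrt hl
  have hs0 := Real.sqrt_nonneg (Real.log (1 / ε))
  have hεexp : ε = Real.exp (-Real.log (1 / ε)) := by
    rw [one_div, Real.log_inv, neg_neg, Real.exp_log hε]
  set l := Real.log (1 / ε)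
  set s := Real.sqrt l
  have hwm : 1 / w ≤ max (1 / w) s := le_max_left _ _
  have hsm : s ≤ max (1 / w) s := le_max_right _ _
  set M := 1 + max (1 / w) s with hM
  have hM1 : 1 ≤ M := by linarith
  have hM0 : 0 < M := by linarith
  have hu0 : 0 ≤ (1 + s) / M := by positivity
  have hu1 : (1 + s) / M ≤ 1 := by rw [div_le_one hM0]; linarith
  obtain ⟨p, hp, hpx⟩ := exists_polynomial_abs_sub_exp_neg_sq_le
    (r := Real.pi / (8 * w ^ 2)) (by positivity) ⌈2 * (1 + s) * M⌉₊ hu0 hu1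
  refine ⟨p, ?_, fun x hx => ?_⟩
  · have h1 : (p.natDegree : ℝ) ≤ 2 * (⌈2 * (1 + s) * M⌉₊ : ℝ) := by exact_mod_cast hp
    have h2 := (Nat.ceil_lt_add_one (a := 2 * (1 + s) * M) (by positivity)).le
    nlinarith [mul_nonneg hs0 hM0.le]
  · have harg : -(Real.pi * x ^ 2) / (2 * w ^ 2) = -(4 * (Real.pi / (8 * w ^ 2)) * x ^ 2) := by
      field_simp
      ring
    rw [harg]
    refine (hpx x hx).trans ?_
    have h1 : 2 * (1 + s) ^ 2 ≤ ⌈2 * (1 + s) * M⌉₊ * ((1 + s) / M) :=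
      calc 2 * (1 + s) ^ 2 = 2 * (1 + s) * M * ((1 + s) / M) := by field_simp
        _ ≤ _ := mul_le_mul_of_nonneg_right (Nat.le_ceil _) hu0
    have h2 : 2 * (Real.pi / (8 * w ^ 2)) * ((1 + s) / M) ^ 2 ≤ (1 + s) ^ 2 := by
      have h3 : 1 / (w * M) ≤ 1 := by
        rw [div_le_one (by positivity)]
        have : 1 ≤ M * w := (div_le_iff₀ hw).mp (by linarith)
        linarith
      calc 2 * (Real.pi / (8 * w ^ 2)) * ((1 + s) / M) ^ 2
          = Real.pi / 4 * (1 / (w * M)) ^ 2 * (1 + s) ^ 2 := by field_simp; ring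
        _ ≤ 1 * 1 ^ 2 * (1 + s) ^ 2 := by
            gcongr
            linarith [Real.pi_le_four]
        _ = (1 + s) ^ 2 := by ring
    have h4 : (2 : ℝ) ≤ Real.exp 1 := by linarith [Real.add_one_le_exp (1 : ℝ)]
    calc _ ≤ Real.exp 1 * Real.exp (-(1 + s) ^ 2) :=
          mul_le_mul h4 (Real.exp_le_exp.mpr (by linarith)) (Real.exp_pos _).le (Real.exp_pos _).le
      _ = Real.exp (1 - (1 + s) ^ 2) := by rw [← Real.exp_add]; ring_nf
      _ ≤ Real.exp (-l) := Real.exp_le_exp.mpr (by nlinarith)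
      _ = ε := hεexp.symm
end

section
/- For every integer T ≥ 1 and all integers i, j with 0 ≤ i < j ≤ T−1, |2cos((i+1)π/(T+1)) − 2cos((j+1)π/(T+1))| ≥ π²/(4(T+1)²). -/
/-- Jordan's inequality, symmetrized about `π / 2`. -/
theorem two_div_pi_mul_le_sin_of_le_of_le_pi_sub {c x : ℝ} (hc : 0 ≤ c) (hcx : c ≤ x)
    (hx : x ≤ Real.pi - c) : 2 / Real.pi * c ≤ Real.sin x := by
  have hπ : 0 ≤ 2 / Real.pi := by positivity
  rcases le_total x (Real.pi / 2) with h | h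
  · exact (mul_le_mul_of_nonneg_left hcx hπ).trans (Real.mul_le_sin (hc.trans hcx) h)
  · rw [← Real.sin_pi_sub]
    have hc' : c ≤ Real.pi - x := by linarith
    exact (mul_le_mul_of_nonneg_left hc' hπ).trans
      (Real.mul_le_sin (hc.trans hc') (by linarith))

/-- Points of `[0, π]` at distance at least `θ` have cosines at distance at least `θ ^ 2 / 8`. -/
theorem sq_div_eight_le_cos_sub_cos {a b θ : ℝ} (hθ : 0 ≤ θ) (ha : 0 ≤ a) (hab : a + θ ≤ b)
    (hb : b ≤ Real.pi) : θ ^ 2 / 8 ≤ Real.cos a - Real.cos b := by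
  have hs := two_div_pi_mul_le_sin_of_le_of_le_pi_sub (c := θ / 2) (x := (a + b) / 2)
    (by linarith) (by linarith) (by linarith)
  have hd := two_div_pi_mul_le_sin_of_le_of_le_pi_sub (c := θ / 2) (x := (b - a) / 2)
    (by linarith) (by linarith) (by linarith)
  have hcos : Real.cos a - Real.cos b =
      2 * (Real.sin ((a + b) / 2) * Real.sin ((b - a) / 2)) := by
    rw [Real.cos_sub_cos, ← neg_sub b a, neg_div, Real.sin_neg]
    ring
  have hπ : θ / 4 ≤ 2 / Real.pi * (θ / 2) := by
    have h : 1 / 2 ≤ 2 / Real.pi := by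
      rw [div_le_div_iff₀ two_pos Real.pi_pos]
      linarith [Real.pi_le_four]
    nlinarith
  have hprod := mul_le_mul (hπ.trans hs) (hπ.trans hd) (by positivity)
    ((by positivity : 0 ≤ θ / 4).trans (hπ.trans hs))
  rw [hcos]
  linarith

/-- Minimum spacing of path-graph eigenvalues: for `0 ≤ i < j ≤ T-1`,
`|2cos((i+1)π/(T+1)) − 2cos((j+1)π/(T+1))| ≥ π²/(4(T+1)²)`. -/
theorem eigenvalue_spacing (T : ℕ) (hT : 1 ≤ T) (i j : ℕ) (hij : i < j) (hj : j ≤ T - 1) :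
    Real.pi ^ 2 / (4 * ((T : ℝ) + 1) ^ 2) ≤
      |2 * Real.cos (((i : ℝ) + 1) * Real.pi / ((T : ℝ) + 1)) -
        2 * Real.cos (((j : ℝ) + 1) * Real.pi / ((T : ℝ) + 1))| := by
  have hT' : (0 : ℝ) < (T : ℝ) + 1 := by positivity
  have hij' : (i : ℝ) + 1 ≤ j := by exact_mod_cast hij
  have hjT : (j : ℝ) + 1 ≤ T := by
    have : j + 1 ≤ T := by omega
    exact_mod_cast this
  have h := sq_div_eight_le_cos_sub_cos (a := ((i : ℝ) + 1) * Real.pi / ((T : ℝ) + 1))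
    (b := ((j : ℝ) + 1) * Real.pi / ((T : ℝ) + 1)) (θ := Real.pi / ((T : ℝ) + 1))
    (by positivity) (by positivity)
    (by
      rw [← add_div]
      gcongr
      nlinarith [Real.pi_pos])
    (by
      rw [div_le_iff₀ hT']
      nlinarith [Real.pi_pos])
  refine le_trans ?_ (le_abs_self _)
  have hθ : Real.pi ^ 2 / (4 * ((T : ℝ) + 1) ^ 2) = 2 * ((Real.pi / ((T : ℝ) + 1)) ^ 2 / 8) := by
    field_simp
    norm_num
  rw [hθ]
  linarith
end

section
/- Let M ≥ 1 be an integer, let x_0,…,x_{M−1} be real numbers with |x_i| ≤ 1 for all i, let c > 0, and let p : ℝ → ℝ satisfy |p(y) − exp(−c·y²/2)| ≤ η for all y ∈ [−1,1], where η > 0 satisfies η·(2+η) < exp(−c). Then ∑_i | p(x_i)²/(∑_j p(x_j)²) − exp(−c·x_i²)/(∑_j exp(−c·x_j²)) | ≤ 2η(2+η) / (exp(−c) − η(2+η)). -/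
/-- Normalizing two families of weights, one of them nonnegative, at most doubles their
`ℓ¹` distance relative to the total weight of the other. -/
theorem sum_abs_div_sum_sub_div_sum_le {ι : Type*} (s : Finset ι) (a b : ι → ℝ)
    (hb : ∀ i ∈ s, 0 ≤ b i) (hA : 0 < ∑ i ∈ s, a i) (hB : 0 < ∑ i ∈ s, b i) :
    ∑ i ∈ s, |a i / ∑ j ∈ s, a j - b i / ∑ j ∈ s, b j| ≤
      2 * (∑ i ∈ s, |a i - b i|) / ∑ i ∈ s, a i := by
  set A := ∑ i ∈ s, a i with hAdef
  set B := ∑ i ∈ s, b i with hBdef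
  have hdiff : |B - A| ≤ ∑ i ∈ s, |a i - b i| := by
    rw [abs_sub_comm, hAdef, hBdef, ← Finset.sum_sub_distrib]
    exact Finset.abs_sum_le_sum_abs _ _
  have hterm : ∀ i ∈ s, |a i / A - b i / B| ≤ |a i - b i| / A + b i * (|B - A| / (A * B)) := by
    intro i hi
    have hsplit : a i / A - b i / B = (a i - b i) / A + b i * ((B - A) / (A * B)) := by
      field_simp
      ring
    rw [hsplit]
    refine (abs_add_le _ _).trans_eq ?_
    rw [abs_div, abs_mul, abs_div, abs_of_pos hA, abs_of_pos (mul_pos hA hB),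
      abs_of_nonneg (hb i hi)]
  calc ∑ i ∈ s, |a i / A - b i / B|
      ≤ ∑ i ∈ s, (|a i - b i| / A + b i * (|B - A| / (A * B))) := Finset.sum_le_sum hterm
    _ = ((∑ i ∈ s, |a i - b i|) + |B - A|) / A := by
      rw [Finset.sum_add_distrib, ← Finset.sum_div, ← Finset.sum_mul, ← hBdef]
      field_simp
    _ ≤ 2 * (∑ i ∈ s, |a i - b i|) / A := by
      gcongr
      linarith

/-- If `u` is within `η` of some `v ∈ [0, 1]`, then `u ^ 2` is within `η * (2 + η)` of `v ^ 2`. -/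
theorem abs_sq_sub_sq_le_mul_two_add {u v η : ℝ} (hv : 0 ≤ v) (hv1 : v ≤ 1) (h : |u - v| ≤ η) :
    |u ^ 2 - v ^ 2| ≤ η * (2 + η) := by
  obtain ⟨h1, h2⟩ := abs_le.mp h
  have hη : 0 ≤ η := (abs_nonneg _).trans h
  rw [show u ^ 2 - v ^ 2 = (u - v) * (u + v) by ring, abs_mul]
  have hsum : |u + v| ≤ 2 + η := abs_le.mpr ⟨by linarith, by linarith⟩
  gcongr

/-- ℓ¹ comparison of the normalized polynomial-filtered and Gaussian eigenvalue
distributions (intermediate bound). -/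
theorem poly_gaussian_l1_bound (M : ℕ) (hM : 1 ≤ M) (x : Fin M → ℝ) (hx : ∀ i, |x i| ≤ 1)
    (c : ℝ) (hc : 0 < c) (p : ℝ → ℝ) (η : ℝ) (hη : 0 < η)
    (hηc : η * (2 + η) < Real.exp (-c))
    (hp : ∀ y ∈ Set.Icc (-1 : ℝ) 1, |p y - Real.exp (-c * y ^ 2 / 2)| ≤ η) :
    ∑ i : Fin M,
        |p (x i) ^ 2 / (∑ j : Fin M, p (x j) ^ 2) -
          Real.exp (-c * x i ^ 2) / (∑ j : Fin M, Real.exp (-c * x j ^ 2))| ≤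
      2 * η * (2 + η) / (Real.exp (-c) - η * (2 + η)) := by
  have hx2 : ∀ i, x i ^ 2 ≤ 1 := fun i => (sq_le_one_iff_abs_le_one _).mpr (hx i)
  have hclose : ∀ i, |p (x i) ^ 2 - Real.exp (-c * x i ^ 2)| ≤ η * (2 + η) := by
    intro i
    have hsq : Real.exp (-c * x i ^ 2) = Real.exp (-c * x i ^ 2 / 2) ^ 2 := by
      rw [← Real.exp_nat_mul]
      congr 1
      push_cast
      ring
    rw [hsq]
    refine abs_sq_sub_sq_le_mul_two_add (Real.exp_pos _).le ?_ (hp _ (abs_le.mp (hx i)))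
    rw [Real.exp_le_one_iff]
    nlinarith [mul_nonneg hc.le (sq_nonneg (x i))]
  have hexp : ∀ i, Real.exp (-c) ≤ Real.exp (-c * x i ^ 2) := by
    intro i
    rw [Real.exp_le_exp]
    nlinarith [mul_le_mul_of_nonneg_left (hx2 i) hc.le]
  have hM0 : (0 : ℝ) < M := by exact_mod_cast hM
  have hgap : 0 < Real.exp (-c) - η * (2 + η) := sub_pos.mpr hηc
  have hA : M * (Real.exp (-c) - η * (2 + η)) ≤ ∑ j : Fin M, p (x j) ^ 2 := by
    have h := Finset.card_nsmul_le_sum Finset.univ (fun j : Fin M => p (x j) ^ 2)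
      (Real.exp (-c) - η * (2 + η))
      (fun j _ => by linarith [(abs_le.mp (hclose j)).1, hexp j])
    simpa using h
  have hD : ∑ j : Fin M, |p (x j) ^ 2 - Real.exp (-c * x j ^ 2)| ≤ M * (η * (2 + η)) := by
    have h := Finset.sum_le_card_nsmul Finset.univ
      (fun j : Fin M => |p (x j) ^ 2 - Real.exp (-c * x j ^ 2)|) (η * (2 + η))
      (fun j _ => hclose j)
    simpa using h
  have hB : 0 < ∑ j : Fin M, Real.exp (-c * x j ^ 2) :=
    Finset.sum_pos (fun j _ => Real.exp_pos _) ⟨⟨0, hM⟩, Finset.mem_univ _⟩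
  calc _ ≤ 2 * (∑ j : Fin M, |p (x j) ^ 2 - Real.exp (-c * x j ^ 2)|) /
        ∑ j : Fin M, p (x j) ^ 2 :=
      sum_abs_div_sum_sub_div_sum_le Finset.univ (fun i => p (x i) ^ 2)
        (fun i => Real.exp (-c * x i ^ 2)) (fun _ _ => (Real.exp_pos _).le)
        ((mul_pos hM0 hgap).trans_le hA) hB
    _ ≤ 2 * (M * (η * (2 + η))) / (M * (Real.exp (-c) - η * (2 + η))) := by gcongr
    _ = 2 * η * (2 + η) / (Real.exp (-c) - η * (2 + η)) := by
      rw [show 2 * (M * (η * (2 + η))) = M * (2 * η * (2 + η)) by ring,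
        mul_div_mul_left _ _ hM0.ne']
end
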